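/- arXiv:2411.13823 — 8 statements merged into one kernel-verified Lean document; each statement's English description precedes it below -/
import Mathlib

section
/- Suppose ≿ satisfies Axiom 1 (completeness and transitivity), Axiom 2 (Monotonicity), Axiom 3 (Replacement Monotonicity), and Axiom 4 (Weak Solvability). Then for any x ∈ X, any y ∈ {w,b}, and any α ∈ [0,1], there exists γ ∈ [0,1] such that αδ_x + (1-α)δ_y ∼ αγδ_b + α(1-γ)δ_w + (1-α)δ_y. -/
open Set

noncomputable section

/-- The Dirac lottery `δ_x` at a prize `x`. -/
def delta (x : ℝ) : ℝ → ℝ := fun y => if y = x then 1 else 0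

/-- `p` is a simple lottery on the prize space `X = [w, b]`: a finitely supported
function into `[0,1]` vanishing outside `[w,b]` and summing to `1`. -/
def IsLottery (w b : ℝ) (p : ℝ → ℝ) : Prop :=
  (Function.support p).Finite ∧ (∀ x, 0 ≤ p x ∧ p x ≤ 1) ∧
    (∀ x, x ∉ Icc w b → p x = 0) ∧ (∑ᶠ x, p x) = 1

/-- The probability `p(S)` that a lottery assigns to a set of prizes. -/
def prob (p : ℝ → ℝ) (S : Set ℝ) : ℝ := ∑ᶠ x ∈ S, p x

/-- Indifference: the symmetric part `∼` of `≿`. -/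
def Indiff (R : (ℝ → ℝ) → (ℝ → ℝ) → Prop) (p q : ℝ → ℝ) : Prop := R p q ∧ R q p

/-- Strict preference: the asymmetric part `≻` of `≿`. -/
def StrictPref (R : (ℝ → ℝ) → (ℝ → ℝ) → Prop) (p q : ℝ → ℝ) : Prop := R p q ∧ ¬ R q p

/-- Axiom 1 (first half): `≿` is complete on simple lotteries. -/
def CompleteAx (w b : ℝ) (R : (ℝ → ℝ) → (ℝ → ℝ) → Prop) : Prop :=
  ∀ p q, IsLottery w b p → IsLottery w b q → R p q ∨ R q p

/-- Axiom 1 (second half): `≿` is transitive on simple lotteries. -/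
def TransitiveAx (w b : ℝ) (R : (ℝ → ℝ) → (ℝ → ℝ) → Prop) : Prop :=
  ∀ p q r, IsLottery w b p → IsLottery w b q → IsLottery w b r → R p q → R q r → R p r

/-- Axiom 2 (Monotonicity). -/
def MonotonicityAx (w b : ℝ) (R : (ℝ → ℝ) → (ℝ → ℝ) → Prop) : Prop :=
  ∀ t₁ ∈ Icc (0:ℝ) 1, ∀ t₂ ∈ Icc (0:ℝ) 1,
    (R (t₁ • delta b + (1 - t₁) • delta w) (t₂ • delta b + (1 - t₂) • delta w) ↔ t₂ ≤ t₁)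

/-- Axiom 3 (Replacement Monotonicity). -/
def ReplacementMonotonicityAx (w b : ℝ) (R : (ℝ → ℝ) → (ℝ → ℝ) → Prop) : Prop :=
  ∀ x ∈ Icc w b, ∀ α ∈ Icc (0:ℝ) 1,
    R (α • delta b + (1 - α) • delta x) (α • delta b + (1 - α) • delta w) ∧
    R (α • delta b + (1 - α) • delta w) (α • delta x + (1 - α) • delta w)

/-- Axiom 4 (Weak Solvability). -/
def WeakSolvabilityAx (w b : ℝ) (R : (ℝ → ℝ) → (ℝ → ℝ) → Prop) : Prop :=
  ∀ p, IsLottery w b p → ∃ γ ∈ Icc (0:ℝ) 1, Indiff R p (γ • delta b + (1 - γ) • delta w)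

/-- A family `u π` of utility functions, indexed by the disappointment probability
`π ∈ [0,1]`, is contextual for the threshold `d`. -/
def Contextual (w b d : ℝ) (u : ℝ → ℝ → ℝ) : Prop :=
  (∀ π ∈ Icc (0:ℝ) 1, ∀ μ ∈ Icc (0:ℝ) 1, u π w = u μ w ∧ u π b = u μ b) ∧
  (∀ π ∈ Icc (0:ℝ) 1, u π w < u π b) ∧
  (∀ π ∈ Icc (0:ℝ) 1, ∀ x ∈ Ioo w b, u π x ∈ Icc (u π w) (u π b)) ∧
  (d ≠ b → ∀ x ∈ Ioo w b, ∃ π ∈ Ioo (0:ℝ) 1, ∃ μ ∈ Ioo (0:ℝ) 1, u π x ≠ u μ x)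

/-- The ECU value of a lottery `p`: `V(p) = ∑ₓ p(x) · u_π(x)` where `π = p([w,d])`. -/
def ECUval (w b d : ℝ) (u : ℝ → ℝ → ℝ) (p : ℝ → ℝ) : ℝ :=
  ∑ᶠ x, p x * u (prob p (Icc w d)) x

/-- `(d, u)` is an expected contextual utility (ECU) representation of `≿`. -/
def IsECU (w b : ℝ) (R : (ℝ → ℝ) → (ℝ → ℝ) → Prop) (d : ℝ) (u : ℝ → ℝ → ℝ) : Prop :=
  d ∈ Icc w b ∧ Contextual w b d u ∧
    ∀ p q, IsLottery w b p → IsLottery w b q →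
      (R p q ↔ ECUval w b d u q ≤ ECUval w b d u p)

/-- `φ` assigns to each prize `x` the value `φ_x ∈ [0,1]` with `δ_x ∼ φ_x δ_b + (1-φ_x) δ_w`. -/
def IsPhi (w b : ℝ) (R : (ℝ → ℝ) → (ℝ → ℝ) → Prop) (φ : ℝ → ℝ) : Prop :=
  ∀ x ∈ Icc w b, φ x ∈ Icc (0:ℝ) 1 ∧
    Indiff R (delta x) (φ x • delta b + (1 - φ x) • delta w)

/-- The set `𝒟` defined from the preference relation via the values `φ_x`. -/
def Dset (w b : ℝ) (R : (ℝ → ℝ) → (ℝ → ℝ) → Prop) (φ : ℝ → ℝ) : Set ℝ :=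
  { x | x ∈ Ico w b ∧ ∀ α ∈ Icc (0:ℝ) 1,
      Indiff R (α • delta x + (1 - α) • delta w)
        ((α * φ x) • delta b + (α * (1 - φ x)) • delta w + (1 - α) • delta w) }

theorem isLottery_mix {w b x y t : ℝ} (hx : x ∈ Icc w b) (hy : y ∈ Icc w b)
    (ht : t ∈ Icc (0:ℝ) 1) : IsLottery w b (t • delta x + (1 - t) • delta y) := by
  obtain ⟨h0, h1⟩ := ht
  have hsub : Function.support (t • delta x + (1 - t) • delta y) ⊆
      ((({x, y} : Finset ℝ)) : Set ℝ) := by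
    intro z hz
    by_contra hne
    simp only [Finset.coe_insert, Finset.coe_singleton, mem_insert_iff, mem_singleton_iff,
      not_or] at hne
    exact hz (by simp [delta, hne.1, hne.2])
  refine ⟨(Finset.finite_toSet _).subset hsub, fun z => ?_, fun z hz => ?_, ?_⟩
  · simp only [delta, Pi.add_apply, Pi.smul_apply, smul_eq_mul]
    split_ifs <;> constructor <;> linarith
  · have hzx : z ≠ x := fun h => hz (h ▸ hx)
    have hzy : z ≠ y := fun h => hz (h ▸ hy)
    simp [delta, hzx, hzy]
  · rw [finsum_eq_sum_of_support_subset _ hsub]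
    by_cases hxy : x = y
    · simp [hxy, delta]
    · simp [Finset.sum_pair hxy, delta, hxy, Ne.symm hxy]

/-- Lemma 1: under Axioms 1–4, for any `x ∈ X`, `y ∈ {w,b}` and `α ∈ [0,1]` there is
`γ ∈ [0,1]` with `αδ_x + (1-α)δ_y ∼ αγδ_b + α(1-γ)δ_w + (1-α)δ_y`. -/
theorem stmt_0 (w b : ℝ) (hwb : w < b) (R : (ℝ → ℝ) → (ℝ → ℝ) → Prop)
    (h1c : CompleteAx w b R) (h1t : TransitiveAx w b R)
    (h2 : MonotonicityAx w b R) (h3 : ReplacementMonotonicityAx w b R)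
    (h4 : WeakSolvabilityAx w b R) :
    ∀ x ∈ Icc w b, ∀ y ∈ ({w, b} : Set ℝ), ∀ α ∈ Icc (0:ℝ) 1,
      ∃ γ ∈ Icc (0:ℝ) 1,
        Indiff R (α • delta x + (1 - α) • delta y)
          ((α * γ) • delta b + (α * (1 - γ)) • delta w + (1 - α) • delta y) := by
  intro x hx y hy α hα
  have hw : w ∈ Icc w b := left_mem_Icc.2 hwb.le
  have hb : b ∈ Icc w b := right_mem_Icc.2 hwb.le
  have hα' : 1 - α ∈ Icc (0:ℝ) 1 := ⟨by linarith [hα.2], by linarith [hα.1]⟩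
  have hyX : y ∈ Icc w b := by
    rcases hy with rfl | rfl <;> assumption
  have hp := isLottery_mix hx hyX hα
  obtain ⟨g, hg, hpg, hgp⟩ := h4 _ hp
  have hgl := isLottery_mix hb hw hg
  rcases hy with rfl | rfl
  · have hle : g ≤ α := (h2 α hα g hg).1
      (h1t _ _ _ (isLottery_mix hb hw hα) hp hgl (h3 x hx α hα).2 hpg)
    have hmul : α * (g / α) = g :=
      mul_div_cancel_of_imp' fun h => le_antisymm (h ▸ hle) hg.1
    refine ⟨g / α, ⟨div_nonneg hg.1 hα.1, div_le_one_of_le₀ hle hα.1⟩, ?_⟩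
    have heq : (α * (g / α)) • delta b + (α * (1 - g / α)) • delta y + (1 - α) • delta y =
        g • delta b + (1 - g) • delta y := by
      rw [mul_sub, hmul]
      module
    rw [heq]
    exact ⟨hpg, hgp⟩
  · have hrep := (h3 x hx (1 - α) hα').1
    have hcomm : (1 - α) • delta y + (1 - (1 - α)) • delta x =
        α • delta x + (1 - α) • delta y := by module
    rw [hcomm] at hrep
    have hle : 1 - α ≤ g := (h2 g hg (1 - α) hα').1
      (h1t _ _ _ hgl hp (isLottery_mix hb hw hα') hgp hrep)
    have hmul : α * ((g - (1 - α)) / α) = g - (1 - α) :=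
      mul_div_cancel_of_imp' fun h => by linarith [hg.2]
    refine ⟨(g - (1 - α)) / α, ⟨div_nonneg (by linarith) hα.1,
      div_le_one_of_le₀ (by linarith [hg.2]) hα.1⟩, ?_⟩
    have heq : (α * ((g - (1 - α)) / α)) • delta y +
        (α * (1 - (g - (1 - α)) / α)) • delta w + (1 - α) • delta y =
        g • delta y + (1 - g) • delta w := by
      rw [mul_sub, hmul]
      module
    rw [heq]
    exact ⟨hpg, hgp⟩
end
end

section
/- Suppose ≿ satisfies Axiom 1 (completeness and transitivity), Axiom 2 (Monotonicity), and Axiom 3 (Replacement Monotonicity). If x ∈ X, α ∈ [0,1], η ∈ [0,1], and αδ_x + (1-α)δ_w ∼ ηδ_b + (1-η)δ_w, then η ≤ α. -/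
open Set

noncomputable section

/-- A Dirac lottery at a prize in `[w, b]` is a simple lottery. -/
theorem isLottery_delta {w b y : ℝ} (hy : y ∈ Icc w b) : IsLottery w b (delta y) := by
  refine ⟨(finite_singleton y).subset fun z hz => ?_, fun z => ?_, fun z hz => ?_, ?_⟩
  · by_contra h
    exact hz (if_neg h)
  · unfold delta
    split_ifs <;> norm_num
  · exact if_neg fun h : z = y => hz (h ▸ hy)
  · rw [finsum_eq_single (delta y) y fun z hz => if_neg hz]
    exact if_pos rfl

/-- A convex combination of simple lotteries is a simple lottery. -/
theorem IsLottery.mix {w b : ℝ} {p q : ℝ → ℝ} (hp : IsLottery w b p) (hq : IsLottery w b q)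
    {t : ℝ} (ht : t ∈ Icc (0:ℝ) 1) : IsLottery w b (t • p + (1 - t) • q) := by
  obtain ⟨hpf, hpI, hpX, hps⟩ := hp
  obtain ⟨hqf, hqI, hqX, hqs⟩ := hq
  obtain ⟨ht0, ht1⟩ := ht
  have hpf' : (Function.support (t • p)).Finite :=
    hpf.subset (Function.support_const_smul_subset t p)
  have hqf' : (Function.support ((1 - t) • q)).Finite :=
    hqf.subset (Function.support_const_smul_subset (1 - t) q)
  refine ⟨(hpf'.union hqf').subset (Function.support_add _ _), fun z => ?_, fun z hz => ?_, ?_⟩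
  · obtain ⟨hp0, hp1⟩ := hpI z
    obtain ⟨hq0, hq1⟩ := hqI z
    have h1t : 0 ≤ 1 - t := sub_nonneg.2 ht1
    simp only [Pi.add_apply, Pi.smul_apply, smul_eq_mul]
    refine ⟨by positivity, ?_⟩
    linarith [mul_le_mul_of_nonneg_left hp1 ht0, mul_le_mul_of_nonneg_left hq1 h1t]
  · simp [hpX z hz, hqX z hz]
  · simp only [Pi.add_apply]
    rw [finsum_add_distrib hpf' hqf']
    simp only [Pi.smul_apply]
    rw [← smul_finsum, ← smul_finsum, hps, hqs]
    simp

/-- Under Axioms 1–3, if `αδ_x + (1-α)δ_w ∼ ηδ_b + (1-η)δ_w` then `η ≤ α`. -/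
theorem stmt_1 (w b : ℝ) (hwb : w < b) (R : (ℝ → ℝ) → (ℝ → ℝ) → Prop)
    (h1c : CompleteAx w b R) (h1t : TransitiveAx w b R)
    (h2 : MonotonicityAx w b R) (h3 : ReplacementMonotonicityAx w b R)
    (x : ℝ) (hx : x ∈ Icc w b) (α : ℝ) (hα : α ∈ Icc (0:ℝ) 1)
    (η : ℝ) (hη : η ∈ Icc (0:ℝ) 1)
    (hind : Indiff R (α • delta x + (1 - α) • delta w)
      (η • delta b + (1 - η) • delta w)) :
    η ≤ α := by
  have hw := isLottery_delta (left_mem_Icc.2 hwb.le)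
  have hb := isLottery_delta (right_mem_Icc.2 hwb.le)
  exact (h2 α hα η hη).1 <| h1t _ _ _ (hb.mix hw hα) ((isLottery_delta hx).mix hw hα)
    (hb.mix hw hη) (h3 x hx α hα).2 hind.1
end
end

section
/- If ≿ has an ECU representation with threshold d, then d̃ = d, where d̃ = sup 𝒟 is defined from the preference relation as in the context. -/
open Set

noncomputable section

/-- Summing a function against a combination of two Dirac lotteries. -/
theorem finsum_delta_combination (s t x y : ℝ) (f : ℝ → ℝ) :
    ∑ᶠ z, (s • delta x + t • delta y) z * f z = s * f x + t * f y := by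
  have single : ∀ (c a : ℝ), ∑ᶠ z, c * delta a z * f z = c * f a := fun c a => by
    rw [finsum_eq_single _ a fun z hz => by simp [delta, hz]]
    simp [delta]
  have fin : ∀ (c a : ℝ), (Function.support fun z => c * delta a z * f z).Finite := fun c a =>
    (finite_singleton a).subset fun z hz => by
      by_contra h
      exact hz (by simp [delta, show z ≠ a from h])
  rw [← single s x, ← single t y, ← finsum_add_distrib (fin s x) (fin t y)]
  exact finsum_congr fun z => by simp [add_mul]

theorem prob_delta_combination (s t x y : ℝ) (S : Set ℝ) :
    prob (s • delta x + t • delta y) S =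
      s * S.indicator 1 x + t * S.indicator 1 y := by
  rw [← finsum_delta_combination, prob, finsum_mem_def]
  refine finsum_congr fun z => ?_
  by_cases hz : z ∈ S <;> simp [hz]

theorem isLottery_delta_combination {w b x y t : ℝ} (hx : x ∈ Icc w b) (hy : y ∈ Icc w b)
    (ht : t ∈ Icc (0 : ℝ) 1) : IsLottery w b (t • delta x + (1 - t) • delta y) := by
  obtain ⟨h0, h1⟩ := ht
  refine ⟨(toFinite {x, y}).subset fun z hz => ?_, fun z => ?_, fun z hz => ?_, ?_⟩
  · by_contra h
    simp only [mem_insert_iff, mem_singleton_iff, not_or] at h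
    exact hz (by simp [delta, h.1, h.2])
  · simp only [delta, Pi.add_apply, Pi.smul_apply, smul_eq_mul]
    split_ifs <;> constructor <;> linarith
  · have hzx : z ≠ x := fun h => hz (h ▸ hx)
    have hzy : z ≠ y := fun h => hz (h ▸ hy)
    simp [delta, hzx, hzy]
  · simpa using finsum_delta_combination t (1 - t) x y 1

theorem ECUval_delta_combination (w b d : ℝ) (u : ℝ → ℝ → ℝ) (s t x y : ℝ) :
    ECUval w b d u (s • delta x + t • delta y) =
      s * u (s * (Icc w d).indicator 1 x + t * (Icc w d).indicator 1 y) x +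
      t * u (s * (Icc w d).indicator 1 x + t * (Icc w d).indicator 1 y) y := by
  rw [ECUval, finsum_delta_combination, prob_delta_combination]

theorem delta_eq_combination (x y : ℝ) :
    delta x = (1 : ℝ) • delta x + (1 - 1 : ℝ) • delta y := by simp

section Representation

variable {w b d : ℝ} {R : (ℝ → ℝ) → (ℝ → ℝ) → Prop} {u : ℝ → ℝ → ℝ} {φ : ℝ → ℝ}

theorem IsECU.indiff_iff (h : IsECU w b R d u) {p q : ℝ → ℝ} (hp : IsLottery w b p)
    (hq : IsLottery w b q) : Indiff R p q ↔ ECUval w b d u p = ECUval w b d u q := by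
  rw [Indiff, h.2.2 p q hp hq, h.2.2 q p hq hp, and_comm]
  exact le_antisymm_iff.symm

/-- Lotteries over the extreme prizes are evaluated by expected utility. -/
theorem IsECU.ECUval_extremes (h : IsECU w b R d u) {t : ℝ} (ht : t ∈ Icc (0 : ℝ) 1) :
    ECUval w b d u (t • delta b + (1 - t) • delta w) = t * u 1 b + (1 - t) * u 1 w := by
  rw [ECUval_delta_combination]
  obtain ⟨h0, h1⟩ := ht
  have hπ : t * (Icc w d).indicator 1 b + (1 - t) * (Icc w d).indicator 1 w ∈ Icc (0 : ℝ) 1 := by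
    simp only [indicator, Pi.one_apply]
    split_ifs <;> constructor <;> linarith
  obtain ⟨hw, hb⟩ := h.2.1.1 _ hπ 1 ⟨zero_le_one, le_rfl⟩
  rw [hw, hb]

/-- A mixture of `x` with the worst prize, of disappointment probability `π`, is indifferent to
the corresponding mixture of extremes iff `u π x` agrees with the value of `φ x`. -/
theorem IsECU.indiff_mixture_iff (h : IsECU w b R d u) (hφ : IsPhi w b R φ) (hwb : w < b)
    {x α : ℝ} (hx : x ∈ Icc w b) (hα : α ∈ Icc (0 : ℝ) 1) :
    Indiff R (α • delta x + (1 - α) • delta w)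
        ((α * φ x) • delta b + (α * (1 - φ x)) • delta w + (1 - α) • delta w) ↔
      α * u (α * (Icc w d).indicator 1 x + (1 - α)) x =
        α * (φ x * u 1 b + (1 - φ x) * u 1 w) := by
  obtain ⟨⟨hφ0, hφ1⟩, -⟩ := hφ x hx
  have hwX : w ∈ Icc w b := left_mem_Icc.2 hwb.le
  have hbX : b ∈ Icc w b := right_mem_Icc.2 hwb.le
  have hαφ : α * φ x ∈ Icc (0 : ℝ) 1 :=
    ⟨mul_nonneg hα.1 hφ0, mul_le_one₀ hα.2 hφ0 hφ1⟩
  have hmix : (α * φ x) • delta b + (α * (1 - φ x)) • delta w + (1 - α) • delta w =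
      (α * φ x) • delta b + (1 - α * φ x) • delta w := by module
  rw [hmix, h.indiff_iff (isLottery_delta_combination hx hwX hα)
    (isLottery_delta_combination hbX hwX hαφ), h.ECUval_extremes hαφ, ECUval_delta_combination,
    indicator_of_mem (left_mem_Icc.2 h.1.1) 1, Pi.one_apply, mul_one]
  have hπ : α * (Icc w d).indicator 1 x + (1 - α) ∈ Icc (0 : ℝ) 1 := by
    obtain ⟨h0, h1⟩ := hα
    simp only [indicator, Pi.one_apply]
    split_ifs <;> constructor <;> linarith
  rw [(h.2.1.1 _ hπ 1 ⟨zero_le_one, le_rfl⟩).1]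
  constructor <;> intro e <;> linarith

theorem IsECU.mem_Dset (h : IsECU w b R d u) (hφ : IsPhi w b R φ) (hwb : w < b) {x : ℝ}
    (hx : x ∈ Ico w b) (hxd : x ≤ d) : x ∈ Dset w b R φ := by
  have hxX := Ico_subset_Icc_self hx
  have hu : u 1 x = φ x * u 1 b + (1 - φ x) * u 1 w := by
    obtain ⟨hφx, hind⟩ := hφ x hxX
    have hwX : w ∈ Icc w b := left_mem_Icc.2 hwb.le
    rw [delta_eq_combination x w,
      h.indiff_iff (isLottery_delta_combination hxX hwX ⟨zero_le_one, le_rfl⟩)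
      (isLottery_delta_combination (right_mem_Icc.2 hwb.le) hwX hφx), h.ECUval_extremes hφx,
      ECUval_delta_combination, indicator_of_mem (show x ∈ Icc w d from ⟨hx.1, hxd⟩)] at hind
    simpa using hind
  refine ⟨hx, fun α hα => (h.indiff_mixture_iff hφ hwb hxX hα).2 ?_⟩
  rw [indicator_of_mem (show x ∈ Icc w d from ⟨hx.1, hxd⟩), Pi.one_apply, mul_one,
    add_sub_cancel, hu]

theorem IsECU.le_of_mem_Dset (h : IsECU w b R d u) (hφ : IsPhi w b R φ) (hwb : w < b) {x : ℝ}
    (hx : x ∈ Dset w b R φ) : x ≤ d := by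
  by_contra! hdx
  obtain ⟨hxI, hind⟩ := hx
  have hconst : ∀ π ∈ Ioo (0 : ℝ) 1, u π x = φ x * u 1 b + (1 - φ x) * u 1 w := by
    intro π hπ
    have hα : 1 - π ∈ Icc (0 : ℝ) 1 := ⟨by linarith [hπ.2], by linarith [hπ.1]⟩
    have e := (h.indiff_mixture_iff hφ hwb (Ico_subset_Icc_self hxI) hα).1 (hind _ hα)
    rw [indicator_of_notMem (fun hm => hdx.not_ge hm.2), mul_zero, zero_add, sub_sub_cancel] at e
    exact mul_left_cancel₀ (by linarith [hπ.2]) e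
  obtain ⟨π, hπ, μ, hμ, hne⟩ :=
    h.2.1.2.2.2 (hdx.trans hxI.2).ne x ⟨h.1.1.trans_lt hdx, hxI.2⟩
  exact hne ((hconst π hπ).trans (hconst μ hμ).symm)

end Representation

/-- Lemma 2: if `≿` has an ECU representation with threshold `d`, then `d̃ = sup 𝒟 = d`. -/
theorem stmt_3 (w b : ℝ) (hwb : w < b) (R : (ℝ → ℝ) → (ℝ → ℝ) → Prop)
    (d : ℝ) (u : ℝ → ℝ → ℝ) (hECU : IsECU w b R d u)
    (φ : ℝ → ℝ) (hφ : IsPhi w b R φ) :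
    sSup (Dset w b R φ) = d := by
  refine IsLUB.csSup_eq ⟨fun x hx => hECU.le_of_mem_Dset hφ hwb hx, fun c hc => ?_⟩
    ⟨w, hECU.mem_Dset hφ hwb ⟨le_rfl, hwb⟩ hECU.1.1⟩
  rcases hECU.1.2.lt_or_eq with hdb | rfl
  · exact hc (hECU.mem_Dset hφ hwb ⟨hECU.1.1, hdb⟩ le_rfl)
  · exact (isLUB_Ico hwb).2 fun x hx => hc (hECU.mem_Dset hφ hwb hx hx.2.le)
end
end

section
/- If ≿ has an ECU representation with threshold d and d ≠ b, then every x ∈ [w,d] belongs to 𝒟. -/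
open Set

noncomputable section

lemma finsum_ternary_mul (a c e x y z : ℝ) (f : ℝ → ℝ) :
    ∑ᶠ t, (a • delta x + c • delta y + e • delta z) t * f t = a * f x + c * f y + e * f z := by
  have hsub : (Function.support fun t => (a • delta x + c • delta y + e • delta z) t * f t) ⊆
      (({x, y, z} : Finset ℝ) : Set ℝ) := by
    intro t ht
    by_contra hn
    simp only [Finset.coe_insert, Finset.coe_singleton, mem_insert_iff, mem_singleton_iff,
      not_or] at hn
    exact ht (by simp [delta, hn])
  rw [finsum_eq_sum_of_support_subset _ hsub]
  simp [delta, add_mul, Finset.sum_add_distrib]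

lemma isLottery_ternary {w b a c e x y z : ℝ} (ha : 0 ≤ a) (hc : 0 ≤ c) (he : 0 ≤ e)
    (hsum : a + c + e = 1) (hx : x ∈ Icc w b) (hy : y ∈ Icc w b) (hz : z ∈ Icc w b) :
    IsLottery w b (a • delta x + c • delta y + e • delta z) := by
  refine ⟨(Set.toFinite {x, y, z}).subset ?_, ?_, ?_, ?_⟩
  · intro t ht
    by_contra hn
    simp only [mem_insert_iff, mem_singleton_iff, not_or] at hn
    exact ht (by simp [delta, hn])
  · intro t
    simp only [Pi.add_apply, Pi.smul_apply, smul_eq_mul, delta]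
    split_ifs <;> constructor <;> linarith
  · intro t ht
    have h1 : t ≠ x := fun h => ht (h ▸ hx)
    have h2 : t ≠ y := fun h => ht (h ▸ hy)
    have h3 : t ≠ z := fun h => ht (h ▸ hz)
    simp [delta, h1, h2, h3]
  · simpa [hsum] using finsum_ternary_mul a c e x y z fun _ => 1

lemma prob_ternary (a c e x y z : ℝ) (S : Set ℝ) :
    prob (a • delta x + c • delta y + e • delta z) S =
      a * S.indicator 1 x + c * S.indicator 1 y + e * S.indicator 1 z := by
  rw [← finsum_ternary_mul, prob, finsum_mem_def]
  refine finsum_congr fun t => ?_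
  by_cases ht : t ∈ S <;> simp [ht]

/-- The ECU value of a lottery on a disappointing prize `x`, the best prize and the worst prize. -/
lemma ECUval_ternary {w b d x : ℝ} (u : ℝ → ℝ → ℝ) (hdb : d < b) (hx : x ∈ Icc w d)
    (a c e : ℝ) :
    ECUval w b d u (a • delta x + c • delta b + e • delta w) =
      a * u (a + e) x + c * u (a + e) b + e * u (a + e) w := by
  have hw : w ∈ Icc w d := ⟨le_rfl, hx.1.trans hx.2⟩
  have hb : b ∉ Icc w d := fun h => hdb.not_ge h.2
  rw [ECUval, finsum_ternary_mul, prob_ternary]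
  simp [indicator_of_mem hx, indicator_of_mem hw, indicator_of_notMem hb]

/-- If `≿` has an ECU representation with threshold `d ≠ b`, then every `x ∈ [w,d]`
belongs to `𝒟`. -/
theorem stmt_4 (w b : ℝ) (hwb : w < b) (R : (ℝ → ℝ) → (ℝ → ℝ) → Prop)
    (d : ℝ) (u : ℝ → ℝ → ℝ) (hECU : IsECU w b R d u) (hd : d ≠ b)
    (φ : ℝ → ℝ) (hφ : IsPhi w b R φ) :
    ∀ x ∈ Icc w d, x ∈ Dset w b R φ := by
  intro x hx
  obtain ⟨⟨-, hdb'⟩, ⟨hwb_const, -, -, -⟩, hR⟩ := hECU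
  have hdb : d < b := lt_of_le_of_ne hdb' hd
  have hxX : x ∈ Icc w b := ⟨hx.1, hx.2.trans hdb'⟩
  have hwX : w ∈ Icc w b := ⟨le_rfl, hwb.le⟩
  have hbX : b ∈ Icc w b := ⟨hwb.le, le_rfl⟩
  have indiff_iff : ∀ p q, IsLottery w b p → IsLottery w b q →
      (Indiff R p q ↔ ECUval w b d u p = ECUval w b d u q) := fun p q hp hq => by
    rw [Indiff, hR p q hp hq, hR q p hq hp, and_comm, le_antisymm_iff]
  have hconst : ∀ π ∈ Icc (0 : ℝ) 1, u π w = u 1 w ∧ u π b = u 1 b := fun π hπ =>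
    hwb_const π hπ 1 ⟨zero_le_one, le_rfl⟩
  obtain ⟨⟨hφ0, hφ1⟩, hind⟩ := hφ x hxX
  have key : u 1 x = φ x * u 1 b + (1 - φ x) * u 1 w := by
    have e₁ : delta x = (1 : ℝ) • delta x + (0 : ℝ) • delta b + (0 : ℝ) • delta w := by simp
    have e₂ : φ x • delta b + (1 - φ x) • delta w =
        (0 : ℝ) • delta x + φ x • delta b + (1 - φ x) • delta w := by simp
    have hV := (indiff_iff _ _
      (isLottery_ternary zero_le_one le_rfl le_rfl (by norm_num) hxX hbX hwX)
      (isLottery_ternary le_rfl hφ0 (sub_nonneg.2 hφ1) (by ring) hxX hbX hwX)).1 (by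
        rwa [← e₁, ← e₂])
    rw [ECUval_ternary u hdb hx, ECUval_ternary u hdb hx] at hV
    obtain ⟨h1, h2⟩ := hconst (0 + (1 - φ x)) ⟨by linarith, by linarith⟩
    rw [h1, h2] at hV
    simpa using hV
  refine ⟨⟨hx.1, hx.2.trans_lt hdb⟩, fun α ⟨hα0, hα1⟩ => ?_⟩
  have e₁ : α • delta x + (1 - α) • delta w =
      α • delta x + (0 : ℝ) • delta b + (1 - α) • delta w := by simp
  have e₂ : (α * φ x) • delta b + (α * (1 - φ x)) • delta w + (1 - α) • delta w =
      (0 : ℝ) • delta x + (α * φ x) • delta b + (1 - α * φ x) • delta w := by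
    module
  have hαφ0 : 0 ≤ α * φ x := mul_nonneg hα0 hφ0
  have hαφ1 : α * φ x ≤ 1 := mul_le_one₀ hα1 hφ0 hφ1
  rw [e₁, e₂, indiff_iff _ _
      (isLottery_ternary hα0 le_rfl (by linarith) (by ring) hxX hbX hwX)
      (isLottery_ternary le_rfl hαφ0 (by linarith) (by ring) hxX hbX hwX),
    ECUval_ternary u hdb hx, ECUval_ternary u hdb hx]
  obtain ⟨h1, h2⟩ := hconst (0 + (1 - α * φ x)) ⟨by linarith, by linarith⟩
  rw [h1, h2, add_sub_cancel, key]
  ring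
end
end

section
/- Suppose ≿ satisfies Axioms 1–4, Axiom 5 (Contextual Substitutability, stated via the derived quantities d̃ and φ_x^α), and the richness condition: if d̃ ≠ b, then for every x ∈ (w,b) there exist π,μ ∈ (0,1) with φ_x^π ≠ φ_x^μ. Then ≿ has an ECU representation. -/
open Set

noncomputable section

/-- The binary lottery yielding `b` with probability `t` and `w` otherwise. -/
def binary (w b t : ℝ) : ℝ → ℝ := t • delta b + (1 - t) • delta w

theorem binary_apply (w b t y : ℝ) :
    binary w b t y = t * delta b y + (1 - t) * delta w y := rfl

theorem isLottery_binary {w b t : ℝ} (hwb : w < b) (ht : t ∈ Icc (0 : ℝ) 1) :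
    IsLottery w b (binary w b t) := by
  obtain ⟨h0, h1⟩ := ht
  have hsub : Function.support (binary w b t) ⊆ (({w, b} : Finset ℝ) : Set ℝ) := by
    intro x hx
    by_contra hx'
    simp only [Finset.coe_insert, Finset.coe_singleton, mem_insert_iff, mem_singleton_iff,
      not_or] at hx'
    exact hx (by simp [binary_apply, delta, hx'.1, hx'.2])
  refine ⟨(Finset.finite_toSet _).subset hsub, fun x => ?_, fun x hx => ?_, ?_⟩
  · rw [binary_apply]
    unfold delta
    split_ifs <;> constructor <;> linarith
  · by_contra hne
    have hx' := hsub hne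
    simp only [Finset.coe_insert, Finset.coe_singleton, mem_insert_iff, mem_singleton_iff] at hx'
    rcases hx' with rfl | rfl
    · exact hx (left_mem_Icc.2 hwb.le)
    · exact hx (right_mem_Icc.2 hwb.le)
  · rw [finsum_eq_sum_of_support_subset _ hsub, Finset.sum_pair hwb.ne]
    simp [binary_apply, delta, hwb.ne, hwb.ne']

theorem eq_of_indiff_binary {w b s t : ℝ} {R : (ℝ → ℝ) → (ℝ → ℝ) → Prop}
    (h2 : MonotonicityAx w b R) (hs : s ∈ Icc (0 : ℝ) 1) (ht : t ∈ Icc (0 : ℝ) 1)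
    (h : Indiff R (binary w b s) (binary w b t)) : s = t :=
  le_antisymm ((h2 t ht s hs).1 h.2) ((h2 s hs t ht).1 h.1)

theorem IsLottery.prob_nonneg {w b : ℝ} {p : ℝ → ℝ} (hp : IsLottery w b p) (S : Set ℝ) :
    0 ≤ prob p S :=
  finsum_nonneg fun x => finsum_nonneg fun _ => (hp.2.1 x).1

theorem IsLottery.prob_add_compl {w b : ℝ} {p : ℝ → ℝ} (hp : IsLottery w b p) (S : Set ℝ) :
    prob p S + prob p Sᶜ = 1 := by
  unfold prob
  rw [← hp.2.2.2, finsum_mem_def, finsum_mem_def,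
    ← finsum_add_distrib (hp.1.subset (by simp)) (hp.1.subset (by simp))]
  exact finsum_congr fun x => Set.indicator_self_add_compl_apply S p x

theorem IsLottery.le_prob {w b : ℝ} {p : ℝ → ℝ} (hp : IsLottery w b p) {S : Set ℝ} {x : ℝ}
    (hx : x ∈ S) : p x ≤ prob p S := by
  unfold prob
  rw [finsum_mem_def]
  have h := single_le_finsum (f := S.indicator p) x (hp.1.subset (by simp))
    (fun y => Set.indicator_nonneg (fun z _ => (hp.2.1 z).1) y)
  rwa [Set.indicator_of_mem hx] at h

theorem IsLottery.finsum_mul_mem_Icc {w b : ℝ} {p : ℝ → ℝ} (hp : IsLottery w b p) {v : ℝ → ℝ}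
    (hv : ∀ x, v x ∈ Icc (0 : ℝ) 1) : ∑ᶠ x, p x * v x ∈ Icc (0 : ℝ) 1 := by
  refine ⟨finsum_nonneg fun x => mul_nonneg (hp.2.1 x).1 (hv x).1, ?_⟩
  rw [← hp.2.2.2]
  exact finsum_le_finsum' (hp.1.subset (Function.support_mul_subset_left p v)) hp.1
    (fun x => mul_le_of_le_one_right (hp.2.1 x).1 (hv x).2)

theorem IsLottery.finsum_mul_binary {w b : ℝ} {p : ℝ → ℝ} (hp : IsLottery w b p) (v : ℝ → ℝ) :
    (fun y => ∑ᶠ x, p x * (v x * delta b y + (1 - v x) * delta w y)) =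
      binary w b (∑ᶠ x, p x * v x) := by
  funext y
  have hv : (Function.support fun x => p x * v x).Finite :=
    hp.1.subset (Function.support_mul_subset_left p v)
  have hv' : (Function.support fun x => p x * (1 - v x)).Finite :=
    hp.1.subset (Function.support_mul_subset_left p _)
  have hcompl : ∑ᶠ x, p x * (1 - v x) = 1 - ∑ᶠ x, p x * v x := by
    rw [eq_sub_iff_add_eq, ← finsum_add_distrib hv' hv]
    refine Eq.trans ?_ hp.2.2.2
    exact finsum_congr fun x => by ring
  rw [binary_apply, ← hcompl, finsum_mul, finsum_mul, ← finsum_add_distrib]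
  · exact finsum_congr fun x => by ring
  · exact hv.subset (Function.support_mul_subset_left _ _)
  · exact hv'.subset (Function.support_mul_subset_left _ _)

theorem left_mem_Dset {w b : ℝ} {R : (ℝ → ℝ) → (ℝ → ℝ) → Prop} {φ : ℝ → ℝ} (hwb : w < b)
    (h2 : MonotonicityAx w b R) (hφ : IsPhi w b R φ) : w ∈ Dset w b R φ := by
  have h0 : (0 : ℝ) ∈ Icc (0 : ℝ) 1 := by simp
  obtain ⟨hmem, hind⟩ := hφ w (left_mem_Icc.2 hwb.le)
  have hw : delta w = binary w b 0 := by simp [binary]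
  have hz : φ w = 0 := (eq_of_indiff_binary h2 h0 hmem (hw ▸ hind)).symm
  refine ⟨⟨le_rfl, hwb⟩, fun α _ => ?_⟩
  have hl : α • delta w + (1 - α) • delta w = binary w b 0 := by
    rw [← hw, ← add_smul]; simp
  have hr : (α * φ w) • delta b + (α * (1 - φ w)) • delta w + (1 - α) • delta w =
      binary w b 0 := by
    rw [hz, ← hl]; simp
  have hrefl : R (binary w b 0) (binary w b 0) := (h2 0 h0 0 h0).2 le_rfl
  rw [hl, hr]
  exact ⟨hrefl, hrefl⟩

/-- The utility that is `0` at `w`, `1` at `b`, and the truncation of `φa π` to `[0,1]`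
elsewhere. -/
def contextUtility (w b : ℝ) (φa : ℝ → ℝ → ℝ) (π x : ℝ) : ℝ :=
  if x = w then 0 else if x = b then 1 else max 0 (min 1 (φa π x))

theorem contextUtility_left (w b : ℝ) (φa : ℝ → ℝ → ℝ) (π : ℝ) :
    contextUtility w b φa π w = 0 := by
  simp [contextUtility]

theorem contextUtility_right {w b : ℝ} (hwb : w < b) (φa : ℝ → ℝ → ℝ) (π : ℝ) :
    contextUtility w b φa π b = 1 := by
  simp [contextUtility, hwb.ne']

theorem contextUtility_mem_Icc (w b : ℝ) (φa : ℝ → ℝ → ℝ) (π x : ℝ) :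
    contextUtility w b φa π x ∈ Icc (0 : ℝ) 1 := by
  unfold contextUtility
  split_ifs <;> simp

theorem contextUtility_eq {w b : ℝ} {φa : ℝ → ℝ → ℝ} {π x : ℝ} (h : φa π x ∈ Icc (0 : ℝ) 1)
    (hw : x = w → φa π x = 0) (hb : x = b → φa π x = 1) :
    contextUtility w b φa π x = φa π x := by
  unfold contextUtility
  split_ifs with h1 h2
  · exact (hw h1).symm
  · exact (hb h2).symm
  · rw [min_eq_right h.2, max_eq_right h.1]

/-- Theorem 1 (sufficiency): Axioms 1–5 together with the richness condition on the
derived values `φ_x^α` imply that `≿` has an ECU representation. -/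
theorem stmt_9 (w b : ℝ) (hwb : w < b) (R : (ℝ → ℝ) → (ℝ → ℝ) → Prop)
    (h1c : CompleteAx w b R) (h1t : TransitiveAx w b R)
    (h2 : MonotonicityAx w b R) (h3 : ReplacementMonotonicityAx w b R)
    (h4 : WeakSolvabilityAx w b R)
    (φ : ℝ → ℝ) (hφ : IsPhi w b R φ)
    (φa : ℝ → ℝ → ℝ)
    (hφa1 : ∀ x ∈ Icc w (sSup (Dset w b R φ)), ∀ α ∈ Ioc (0:ℝ) 1,
      φa α x ∈ Icc (0:ℝ) 1 ∧
        Indiff R (α • delta x + (1 - α) • delta b)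
          ((α * φa α x) • delta b + (α * (1 - φa α x)) • delta w + (1 - α) • delta b))
    (hφa2 : ∀ x ∈ Icc w b, x ∉ Icc w (sSup (Dset w b R φ)) → ∀ α ∈ Ico (0:ℝ) 1,
      φa α x ∈ Icc (0:ℝ) 1 ∧
        Indiff R (α • delta w + (1 - α) • delta x)
          (α • delta w + ((1 - α) * φa α x) • delta b + ((1 - α) * (1 - φa α x)) • delta w))
    (h5 : ∀ α ∈ Icc (0:ℝ) 1, ∀ p, IsLottery w b p →
      prob p (Icc w (sSup (Dset w b R φ))) = α →
        Indiff R p (fun y => ∑ᶠ x, p x * (φa α x * delta b y + (1 - φa α x) * delta w y)))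
    (hrich : sSup (Dset w b R φ) ≠ b → ∀ x ∈ Ioo w b,
      ∃ π ∈ Ioo (0:ℝ) 1, ∃ μ ∈ Ioo (0:ℝ) 1, φa π x ≠ φa μ x) :
    ∃ d : ℝ, ∃ u : ℝ → ℝ → ℝ, IsECU w b R d u := by
  have hwD := left_mem_Dset hwb h2 hφ
  have hDb : ∀ x ∈ Dset w b R φ, x ≤ b := fun x hx => hx.1.2.le
  have hd : sSup (Dset w b R φ) ∈ Icc w b :=
    ⟨le_csSup ⟨b, hDb⟩ hwD, csSup_le ⟨w, hwD⟩ hDb⟩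
  generalize sSup (Dset w b R φ) = d at *
  have hlow : ∀ x ∈ Icc w d, ∀ π ∈ Ioc (0 : ℝ) 1,
      contextUtility w b φa π x = φa π x := by
    intro x hx π hπ
    obtain ⟨hmem, hind⟩ := hφa1 x hx π hπ
    have hval : π * φa π x + (1 - π) ∈ Icc (0 : ℝ) 1 :=
      ⟨by nlinarith [hπ.1, hπ.2, hmem.1], by nlinarith [hπ.1, hmem.2]⟩
    have hr : (π * φa π x) • delta b + (π * (1 - φa π x)) • delta w + (1 - π) • delta b =
        binary w b (π * φa π x + (1 - π)) := by
      unfold binary; module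
    rw [hr] at hind
    refine contextUtility_eq hmem ?_ ?_
    · rintro rfl
      have hl : π • delta x + (1 - π) • delta b = binary x b (1 - π) := by
        unfold binary; module
      rw [hl] at hind
      have h := eq_of_indiff_binary h2 ⟨by linarith [hπ.2], by linarith [hπ.1]⟩ hval hind
      have h' : π * φa π x = 0 := by linarith
      exact (mul_eq_zero.1 h').resolve_left hπ.1.ne'
    · rintro rfl
      have hl : π • delta x + (1 - π) • delta x = binary w x 1 := by
        unfold binary; module
      rw [hl] at hind
      have h := eq_of_indiff_binary h2 (by simp) hval hind
      exact mul_left_cancel₀ hπ.1.ne' (by linarith)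
  have hhigh : ∀ x ∈ Icc w b, x ∉ Icc w d → ∀ π ∈ Ico (0 : ℝ) 1,
      contextUtility w b φa π x = φa π x := by
    intro x hx hxd π hπ
    obtain ⟨hmem, hind⟩ := hφa2 x hx hxd π hπ
    have hπ' : 0 < 1 - π := sub_pos.2 hπ.2
    refine contextUtility_eq hmem (fun h => (hxd (h.symm ▸ left_mem_Icc.2 hd.1)).elim) ?_
    rintro rfl
    have hl : π • delta w + (1 - π) • delta x = binary w x (1 - π) := by
      unfold binary; module
    have hr : π • delta w + ((1 - π) * φa π x) • delta x + ((1 - π) * (1 - φa π x)) • delta w =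
        binary w x ((1 - π) * φa π x) := by
      unfold binary; module
    rw [hl, hr] at hind
    have h := eq_of_indiff_binary h2 ⟨hπ'.le, by linarith [hπ.1]⟩
      ⟨mul_nonneg hπ'.le hmem.1, by nlinarith [hπ.1, hmem.1, hmem.2]⟩ hind
    exact mul_left_cancel₀ hπ'.ne' (by linarith)
  have hmid : ∀ x ∈ Ioo w b, ∀ π ∈ Ioo (0 : ℝ) 1,
      contextUtility w b φa π x = φa π x := by
    intro x hx π hπ
    by_cases hxd : x ∈ Icc w d
    · exact hlow x hxd π ⟨hπ.1, hπ.2.le⟩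
    · exact hhigh x (Ioo_subset_Icc_self hx) hxd π ⟨hπ.1.le, hπ.2⟩
  have hV : ∀ p, IsLottery w b p →
      ECUval w b d (contextUtility w b φa) p ∈ Icc (0 : ℝ) 1 ∧
      Indiff R p (binary w b (ECUval w b d (contextUtility w b φa) p)) := by
    intro p hp
    refine ⟨hp.finsum_mul_mem_Icc fun x => contextUtility_mem_Icc w b φa _ x, ?_⟩
    have h0 := hp.prob_nonneg (Icc w d)
    have h1 := hp.prob_nonneg (Icc w d)ᶜ
    have hadd := hp.prob_add_compl (Icc w d)
    have hind := h5 _ ⟨h0, by linarith⟩ p hp rfl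
    rw [hp.finsum_mul_binary] at hind
    convert hind using 2
    refine finsum_congr fun x => ?_
    by_cases hpx : p x = 0
    · simp [hpx]
    have hpos : 0 < p x := lt_of_le_of_ne (hp.2.1 x).1 (Ne.symm hpx)
    have hx : x ∈ Icc w b := by
      by_contra h
      exact hpx (hp.2.2.1 x h)
    congr 1
    by_cases hxd : x ∈ Icc w d
    · exact hlow x hxd _ ⟨hpos.trans_le (hp.le_prob hxd), by linarith⟩
    · have := hp.le_prob (S := (Icc w d)ᶜ) hxd
      exact hhigh x hx hxd _ ⟨h0, by linarith⟩
  refine ⟨d, contextUtility w b φa, hd, ⟨?_, ?_, ?_, ?_⟩, ?_⟩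
  · intro π _ μ _
    simp only [contextUtility_left, contextUtility_right hwb, and_self]
  · intro π _
    rw [contextUtility_left, contextUtility_right hwb]
    exact one_pos
  · intro π _ x _
    rw [contextUtility_left, contextUtility_right hwb]
    exact contextUtility_mem_Icc w b φa π x
  · intro hdb x hx
    obtain ⟨π, hπ, μ, hμ, hne⟩ := hrich hdb x hx
    exact ⟨π, hπ, μ, hμ, by rwa [hmid x hx π hπ, hmid x hx μ hμ]⟩
  · intro p q hp hq
    obtain ⟨hpm, hpi⟩ := hV p hp
    obtain ⟨hqm, hqi⟩ := hV q hq
    have hpb := isLottery_binary hwb hpm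
    have hqb := isLottery_binary hwb hqm
    rw [← h2 _ hpm _ hqm]
    exact ⟨fun h => h1t _ _ _ hpb hp hqb hpi.2 (h1t _ _ _ hp hq hqb h hqi.1),
      fun h => h1t _ _ _ hp hpb hq hpi.1 (h1t _ _ _ hpb hqb hq h hqi.2)⟩
end
end

section
/- Suppose ≿ has an ECU representation with threshold d₁ and contextual family (u_α), where d₁ < b, and also has an ECU representation with threshold d₂ and contextual family (v_α). Then d₁ = d₂, and there exist k > 0 and c ∈ ℝ such that v_α(x) = k·u_α(x) + c for all α ∈ (0,1] and x ∈ [w,d₁], and v_α(x) = k·u_α(x) + c for all α ∈ [0,1) and x ∈ X with x > d₁. -/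
open Set

noncomputable section

/-- The lottery yielding `x` with probability `t` and `y` with probability `1 - t`. -/
def binaryLottery (t x y : ℝ) : ℝ → ℝ := t • delta x + (1 - t) • delta y

theorem finsum_binaryLottery_mul (t x y : ℝ) (f : ℝ → ℝ) :
    ∑ᶠ z, binaryLottery t x y z * f z = t * f x + (1 - t) * f y := by
  have hsub : (Function.support fun z => binaryLottery t x y z * f z) ⊆
      (({x, y} : Finset ℝ) : Set ℝ) := by
    intro z hz
    contrapose! hz
    simp at hz
    simp [binaryLottery, delta, hz.1, hz.2]
  rw [finsum_eq_sum_of_support_subset _ hsub]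
  by_cases hxy : x = y
  · subst hxy
    simp [binaryLottery, delta]
    ring
  · rw [Finset.sum_pair hxy]
    simp [binaryLottery, delta, hxy, Ne.symm hxy]

theorem isLottery_binaryLottery {w b t x y : ℝ} (ht : t ∈ Icc (0 : ℝ) 1)
    (hx : x ∈ Icc w b) (hy : y ∈ Icc w b) : IsLottery w b (binaryLottery t x y) := by
  obtain ⟨ht0, ht1⟩ := ht
  refine ⟨(Set.toFinite {x, y}).subset ?_, ?_, ?_, ?_⟩
  · intro z hz
    contrapose! hz
    simp at hz
    simp [binaryLottery, delta, hz.1, hz.2]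
  · intro z
    simp only [binaryLottery, delta, Pi.add_apply, Pi.smul_apply, smul_eq_mul]
    split_ifs <;> constructor <;> linarith
  · intro z hz
    have hzx : z ≠ x := fun h => hz (h ▸ hx)
    have hzy : z ≠ y := fun h => hz (h ▸ hy)
    simp [binaryLottery, delta, hzx, hzy]
  · simpa using finsum_binaryLottery_mul t x y 1

theorem prob_binaryLottery (t x y : ℝ) (S : Set ℝ) :
    prob (binaryLottery t x y) S = t * S.indicator 1 x + (1 - t) * S.indicator 1 y := by
  rw [prob, finsum_mem_def, ← finsum_binaryLottery_mul]
  congr 1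
  ext z
  by_cases hz : z ∈ S <;> simp [hz]

theorem prob_binaryLottery_mem_Icc {t : ℝ} (ht : t ∈ Icc (0 : ℝ) 1) (x y : ℝ) (S : Set ℝ) :
    prob (binaryLottery t x y) S ∈ Icc (0 : ℝ) 1 := by
  obtain ⟨ht0, ht1⟩ := ht
  rw [prob_binaryLottery]
  by_cases hx : x ∈ S <;> by_cases hy : y ∈ S <;> simp [hx, hy, ht0, ht1]

/-- The affine rescaling of a utility family sending the utility of `w` to `0` and that of `b`
to `1`. -/
def normalizedUtility (w b : ℝ) (u : ℝ → ℝ → ℝ) (π x : ℝ) : ℝ :=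
  (u π x - u 0 w) / (u 0 b - u 0 w)

namespace Contextual

variable {w b d : ℝ} {u : ℝ → ℝ → ℝ}

theorem sub_pos (h : Contextual w b d u) : 0 < u 0 b - u 0 w := by
  have := h.2.1 0 (by simp)
  linarith

theorem eq_add_normalizedUtility (h : Contextual w b d u) (π x : ℝ) :
    u π x = u 0 w + (u 0 b - u 0 w) * normalizedUtility w b u π x := by
  have := h.sub_pos.ne'
  rw [normalizedUtility]
  field_simp
  ring

theorem normalizedUtility_worst (h : Contextual w b d u) {π : ℝ} (hπ : π ∈ Icc (0 : ℝ) 1) :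
    normalizedUtility w b u π w = 0 := by
  rw [normalizedUtility, (h.1 π hπ 0 (by simp)).1, sub_self, zero_div]

theorem normalizedUtility_best (h : Contextual w b d u) {π : ℝ} (hπ : π ∈ Icc (0 : ℝ) 1) :
    normalizedUtility w b u π b = 1 := by
  rw [normalizedUtility, (h.1 π hπ 0 (by simp)).2, div_self h.sub_pos.ne']

theorem normalizedUtility_mem_Icc (h : Contextual w b d u) {π x : ℝ}
    (hπ : π ∈ Icc (0 : ℝ) 1) (hx : x ∈ Icc w b) :
    normalizedUtility w b u π x ∈ Icc (0 : ℝ) 1 := by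
  rcases eq_or_lt_of_le hx.1 with rfl | hwx
  · simp [h.normalizedUtility_worst hπ]
  rcases eq_or_lt_of_le hx.2 with rfl | hxb
  · simp [h.normalizedUtility_best hπ]
  have hu := h.2.2.1 π hπ x ⟨hwx, hxb⟩
  rw [(h.1 π hπ 0 (by simp)).1, (h.1 π hπ 0 (by simp)).2] at hu
  have hpos := h.sub_pos
  rw [normalizedUtility]
  exact ⟨div_nonneg (by linarith [hu.1]) hpos.le, (div_le_one hpos).2 (by linarith [hu.2])⟩

theorem ECUval_binaryLottery (h : Contextual w b d u) (t x y : ℝ) {π : ℝ}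
    (hπ : prob (binaryLottery t x y) (Icc w d) = π) :
    ECUval w b d u (binaryLottery t x y) = u 0 w + (u 0 b - u 0 w) *
      (t * normalizedUtility w b u π x + (1 - t) * normalizedUtility w b u π y) := by
  rw [ECUval, hπ, finsum_binaryLottery_mul, h.eq_add_normalizedUtility π x,
    h.eq_add_normalizedUtility π y]
  ring

theorem ECUval_best_worst (h : Contextual w b d u) {t : ℝ} (ht : t ∈ Icc (0 : ℝ) 1) :
    ECUval w b d u (binaryLottery t b w) = u 0 w + (u 0 b - u 0 w) * t := by
  have hπ := prob_binaryLottery_mem_Icc ht b w (Icc w d)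
  rw [h.ECUval_binaryLottery t b w rfl, h.normalizedUtility_worst hπ,
    h.normalizedUtility_best hπ]
  ring

end Contextual

namespace IsECU

variable {w b d₁ d₂ : ℝ} {R : (ℝ → ℝ) → (ℝ → ℝ) → Prop} {u v : ℝ → ℝ → ℝ}

/-- Two ECU representations of the same preference assign every binary lottery the same
normalized value, because that value is its equivalent mixture of `b` and `w`. -/
theorem normalized_value_eq (hwb : w < b) (hu : IsECU w b R d₁ u) (hv : IsECU w b R d₂ v)
    {t x y π μ : ℝ} (ht : t ∈ Icc (0 : ℝ) 1) (hx : x ∈ Icc w b) (hy : y ∈ Icc w b)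
    (hπ : prob (binaryLottery t x y) (Icc w d₁) = π)
    (hμ : prob (binaryLottery t x y) (Icc w d₂) = μ) :
    t * normalizedUtility w b u π x + (1 - t) * normalizedUtility w b u π y =
      t * normalizedUtility w b v μ x + (1 - t) * normalizedUtility w b v μ y := by
  obtain ⟨-, hcu, hRu⟩ := hu
  obtain ⟨-, hcv, hRv⟩ := hv
  set γ := t * normalizedUtility w b u π x + (1 - t) * normalizedUtility w b u π y with hγ_def
  have hγ : γ ∈ Icc (0 : ℝ) 1 := by
    have hπI : π ∈ Icc (0 : ℝ) 1 := hπ ▸ prob_binaryLottery_mem_Icc ht x y _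
    exact convex_Icc (0 : ℝ) 1 (hcu.normalizedUtility_mem_Icc hπI hx)
      (hcu.normalizedUtility_mem_Icc hπI hy) ht.1 (by linarith [ht.2]) (by ring)
  have hp := isLottery_binaryLottery ht hx hy
  have hq := isLottery_binaryLottery hγ (right_mem_Icc.2 hwb.le) (left_mem_Icc.2 hwb.le)
  have hval : ECUval w b d₁ u (binaryLottery t x y) =
      ECUval w b d₁ u (binaryLottery γ b w) := by
    rw [hcu.ECUval_binaryLottery t x y hπ, hcu.ECUval_best_worst hγ]
  have hval' : ECUval w b d₂ v (binaryLottery t x y) =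
      ECUval w b d₂ v (binaryLottery γ b w) :=
    le_antisymm ((hRv _ _ hq hp).1 ((hRu _ _ hq hp).2 hval.le))
      ((hRv _ _ hp hq).1 ((hRu _ _ hp hq).2 hval.ge))
  rw [hcv.ECUval_binaryLottery t x y hμ, hcv.ECUval_best_worst hγ] at hval'
  exact (mul_left_cancel₀ hcv.sub_pos.ne' (add_left_cancel hval')).symm

/-- Comparing `x` mixed with the worst prize, for `x` above the first threshold. -/
theorem normalizedUtility_eq_of_lt (hwb : w < b) (hu : IsECU w b R d₁ u)
    (hv : IsECU w b R d₂ v) {α x μ : ℝ} (hα : α ∈ Ico (0 : ℝ) 1) (hx : x ∈ Icc w b)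
    (hdx : d₁ < x) (hμ : prob (binaryLottery α w x) (Icc w d₂) = μ) :
    normalizedUtility w b u α x = normalizedUtility w b v μ x := by
  have hαI := Ico_subset_Icc_self hα
  have hμI : μ ∈ Icc (0 : ℝ) 1 := hμ ▸ prob_binaryLottery_mem_Icc hαI w x _
  have hπ : prob (binaryLottery α w x) (Icc w d₁) = α := by
    simp [prob_binaryLottery, hu.1.1, hdx.not_ge]
  have := normalized_value_eq hwb hu hv hαI (left_mem_Icc.2 hwb.le) hx hπ hμ
  rw [hu.2.1.normalizedUtility_worst hαI, hv.2.1.normalizedUtility_worst hμI] at this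
  refine mul_left_cancel₀ (sub_pos.2 hα.2).ne' ?_
  linarith

theorem threshold_le (hwb : w < b) (hu : IsECU w b R d₁ u) (hv : IsECU w b R d₂ v) :
    d₂ ≤ d₁ := by
  by_contra! hlt
  obtain ⟨x, hdx, hxd⟩ := exists_between hlt
  have hwx : w < x := hu.1.1.trans_lt hdx
  have hxb : x < b := hxd.trans_le hv.1.2
  have hconst : ∀ α ∈ Ioo (0 : ℝ) 1,
      normalizedUtility w b u α x = normalizedUtility w b v 1 x := fun α hα =>
    normalizedUtility_eq_of_lt hwb hu hv (Ioo_subset_Ico_self hα) ⟨hwx.le, hxb.le⟩ hdx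
      (by simp [prob_binaryLottery, hv.1.1, hwx.le, hxd.le])
  obtain ⟨π, hπ, μ, hμ, hne⟩ := hu.2.1.2.2.2 (hlt.trans_le hv.1.2).ne x ⟨hwx, hxb⟩
  apply hne
  rw [hu.2.1.eq_add_normalizedUtility π x, hu.2.1.eq_add_normalizedUtility μ x,
    hconst π hπ, hconst μ hμ]

end IsECU

/-- Theorem 2 (uniqueness): two ECU representations of `≿` with `d₁ < b` have the same
threshold, and the utility families agree up to a common positive affine transformation. -/
theorem stmt_15 (w b : ℝ) (hwb : w < b) (R : (ℝ → ℝ) → (ℝ → ℝ) → Prop)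
    (d₁ d₂ : ℝ) (u v : ℝ → ℝ → ℝ)
    (hECU₁ : IsECU w b R d₁ u) (hd₁ : d₁ < b) (hECU₂ : IsECU w b R d₂ v) :
    d₁ = d₂ ∧ ∃ k > (0:ℝ), ∃ c : ℝ,
      (∀ α ∈ Ioc (0:ℝ) 1, ∀ x ∈ Icc w d₁, v α x = k * u α x + c) ∧
      (∀ α ∈ Ico (0:ℝ) 1, ∀ x ∈ Icc w b, d₁ < x → v α x = k * u α x + c) := by
  obtain rfl : d₁ = d₂ :=
    le_antisymm (hECU₂.threshold_le hwb hECU₁) (hECU₁.threshold_le hwb hECU₂)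
  have hcu := hECU₁.2.1
  have hcv := hECU₂.2.1
  have hdu := hcu.sub_pos
  have affine : ∀ α x, normalizedUtility w b u α x = normalizedUtility w b v α x →
      v α x = (v 0 b - v 0 w) / (u 0 b - u 0 w) * u α x +
        (v 0 w - (v 0 b - v 0 w) / (u 0 b - u 0 w) * u 0 w) := by
    intro α x h
    rw [hcv.eq_add_normalizedUtility α x, ← h, normalizedUtility]
    ring
  refine ⟨rfl, _, div_pos hcv.sub_pos hdu, _, fun α hα x hx => affine α x ?_,
    fun α hα x hx hdx => affine α x ?_⟩
  · have hαI := Ioc_subset_Icc_self hα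
    have hπ : prob (binaryLottery α x b) (Icc w d₁) = α := by
      simp [prob_binaryLottery, hx.1, hx.2, hd₁.not_ge]
    have := hECU₁.normalized_value_eq hwb hECU₂ hαI ⟨hx.1, hx.2.trans hd₁.le⟩
      (right_mem_Icc.2 hwb.le) hπ hπ
    rw [hcu.normalizedUtility_best hαI, hcv.normalizedUtility_best hαI] at this
    exact mul_left_cancel₀ hα.1.ne' (add_right_cancel this)
  · exact hECU₁.normalizedUtility_eq_of_lt hwb hECU₂ hα hx hdx
      (by simp [prob_binaryLottery, hECU₁.1.1, hdx.not_ge])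
end
end

section
/- Suppose ≿ has an ECU representation with threshold d and contextual family (u_π) such that (Condition 1) u_π is non-decreasing on X for every π ∈ [0,1], and (Condition 2) u_π(x) ≥ u_μ(x) for every x ∈ X and all 0 ≤ π ≤ μ ≤ 1. Then for any simple lotteries p and q such that p first-order stochastically dominates q, we have p ≿ q. -/
open Set

noncomputable section

/-- `p` first-order stochastically dominates `q`. -/
def FOSD (w b : ℝ) (p q : ℝ → ℝ) : Prop :=
  ∀ x ∈ Icc w b, prob p (Icc w x) ≤ prob q (Icc w x)

/-- Abel summation: if every initial partial sum of `r` is nonnegative, then summing `r`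
against a monotone function bounded by `M` gives at most `M` times the total. -/
lemma sum_mul_le_sum_mul_of_partial_sums_nonneg (r f : ℝ → ℝ) (s : Finset ℝ)
    (hf : MonotoneOn f (s : Set ℝ))
    (hr : ∀ x ∈ s, 0 ≤ ∑ y ∈ s with y ≤ x, r y) :
    ∀ M, (∀ x ∈ s, f x ≤ M) → ∑ y ∈ s, r y * f y ≤ (∑ y ∈ s, r y) * M := by
  induction s using Finset.induction_on_max with
  | empty => simp
  | insert a s ha ih =>
    intro M hM
    have has : a ∉ s := fun h => lt_irrefl _ (ha a h)
    have hsum : 0 ≤ ∑ y ∈ insert a s, r y := by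
      have h := hr a (Finset.mem_insert_self a s)
      rwa [Finset.filter_true_of_mem] at h
      intro y hy
      rcases Finset.mem_insert.1 hy with rfl | hy
      · exact le_rfl
      · exact (ha y hy).le
    have hs := ih (hf.mono (by simp)) (fun x hx => by
        have h := hr x (Finset.mem_insert_of_mem hx)
        rwa [Finset.filter_insert, if_neg (not_le.2 (ha x hx))] at h)
      (f a) (fun x hx => hf (by simp [hx]) (by simp) (ha x hx).le)
    calc ∑ y ∈ insert a s, r y * f y = r a * f a + ∑ y ∈ s, r y * f y :=
          Finset.sum_insert has
      _ ≤ r a * f a + (∑ y ∈ s, r y) * f a := by gcongr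
      _ = (∑ y ∈ insert a s, r y) * f a := by rw [Finset.sum_insert has]; ring
      _ ≤ (∑ y ∈ insert a s, r y) * M :=
          mul_le_mul_of_nonneg_left (hM a (Finset.mem_insert_self a s)) hsum

lemma IsLottery.support_subset {w b : ℝ} {p : ℝ → ℝ} (hp : IsLottery w b p) :
    Function.support p ⊆ Icc w b := fun x hx => by
  by_contra h
  exact hx (hp.2.2.1 x h)

lemma prob_Icc_eq_sum_filter {w b : ℝ} {p : ℝ → ℝ} (hp : IsLottery w b p) {s : Finset ℝ}
    (hs : Function.support p ⊆ s) (x : ℝ) :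
    prob p (Icc w x) = ∑ y ∈ s with y ≤ x, p y := by
  refine finsum_mem_eq_sum_of_inter_support_eq p ?_
  ext y
  simp only [mem_inter_iff, mem_Icc, Finset.coe_filter, mem_ofPred_eq]
  constructor
  · rintro ⟨h, hy⟩
    exact ⟨⟨hs hy, h.2⟩, hy⟩
  · rintro ⟨h, hy⟩
    exact ⟨⟨(hp.support_subset hy).1, h.2⟩, hy⟩

lemma prob_Icc_mem_Icc {w b : ℝ} {p : ℝ → ℝ} (hp : IsLottery w b p) (x : ℝ) :
    prob p (Icc w x) ∈ Icc (0 : ℝ) 1 := by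
  have hs : Function.support p ⊆ hp.1.toFinset := by simp
  have h1 : ∑ y ∈ hp.1.toFinset, p y = 1 := by
    rw [← finsum_eq_sum_of_support_subset p hs, hp.2.2.2]
  rw [prob_Icc_eq_sum_filter hp hs]
  exact ⟨Finset.sum_nonneg fun y _ => (hp.2.1 y).1,
    (Finset.sum_le_sum_of_subset_of_nonneg (Finset.filter_subset _ _)
      fun y _ _ => (hp.2.1 y).1).trans_eq h1⟩

/-- Proposition 1: an ECU representation whose contextual family satisfies Condition 1
(each `u_π` non-decreasing) and Condition 2 (`u_π ≥ u_μ` pointwise for `π ≤ μ`)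
represents preferences that respect first-order stochastic dominance. -/
theorem stmt_17 (w b : ℝ) (hwb : w < b) (R : (ℝ → ℝ) → (ℝ → ℝ) → Prop)
    (d : ℝ) (u : ℝ → ℝ → ℝ) (hECU : IsECU w b R d u)
    (hcond1 : ∀ π ∈ Icc (0:ℝ) 1, MonotoneOn (u π) (Icc w b))
    (hcond2 : ∀ x ∈ Icc w b, ∀ π μ : ℝ, 0 ≤ π → π ≤ μ → μ ≤ 1 → u μ x ≤ u π x) :
    ∀ p q, IsLottery w b p → IsLottery w b q → FOSD w b p q → R p q := by
  classical
  intro p q hp hq hpq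
  obtain ⟨hd, -, hR⟩ := hECU
  rw [hR p q hp hq]
  have hπ := prob_Icc_mem_Icc hp d
  have hμ := prob_Icc_mem_Icc hq d
  have hπμ := hpq d hd
  unfold ECUval
  set π := prob p (Icc w d)
  set μ := prob q (Icc w d)
  set s := hp.1.toFinset ∪ hq.1.toFinset with hs
  have hps : Function.support p ⊆ s := by simp [hs]
  have hqs : Function.support q ⊆ s := by simp [hs]
  have hsX : (s : Set ℝ) ⊆ Icc w b := by
    simp [hs, hp.support_subset, hq.support_subset]
  rw [finsum_eq_sum_of_support_subset _ ((Function.support_mul_subset_left _ _).trans hqs),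
    finsum_eq_sum_of_support_subset _ ((Function.support_mul_subset_left _ _).trans hps)]
  have hp1 : ∑ y ∈ s, p y = 1 := by rw [← finsum_eq_sum_of_support_subset p hps, hp.2.2.2]
  have hq1 : ∑ y ∈ s, q y = 1 := by rw [← finsum_eq_sum_of_support_subset q hqs, hq.2.2.2]
  have habel := sum_mul_le_sum_mul_of_partial_sums_nonneg (q - p) (u μ) s
    ((hcond1 μ hμ).mono hsX)
    (fun x hx => by
      have h := hpq x (hsX hx)
      rw [prob_Icc_eq_sum_filter hp hps, prob_Icc_eq_sum_filter hq hqs] at h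
      simpa [Finset.sum_sub_distrib] using h)
    (u μ b) (fun x hx => hcond1 μ hμ (hsX hx) (right_mem_Icc.2 hwb.le) (hsX hx).2)
  simp only [Pi.sub_apply, sub_mul, Finset.sum_sub_distrib, hp1, hq1, sub_self] at habel
  calc ∑ x ∈ s, q x * u μ x ≤ ∑ x ∈ s, p x * u μ x := by linarith
    _ ≤ ∑ x ∈ s, p x * u π x := Finset.sum_le_sum fun x hx =>
        mul_le_mul_of_nonneg_left (hcond2 x (hsX hx) π μ hπ.1 hπμ hμ.2) (hp.2.1 x).1
end
end

section
/- There exist real numbers w < b, a threshold d ∈ [w,b], a value τ ∈ (0,1), strictly increasing functions u, v : [w,b] → ℝ with u(w) = v(w), u(b) = v(b), and v(x) < u(x) for all x ∈ (w,b), and simple lotteries p and q, such that for the binary ECU value function V — defined by V(r) = ∑_{x ∈ supp r} r(x)·u(x) if r([w,d]) ≤ τ, and V(r) = ∑_{x ∈ supp r} r(x)·v(x) if r([w,d]) > τ — one has V(p) > V(q) and V(0.6·p + 0.4·q) > V(p). In particular, the preference relation represented by V violates the betweenness axiom. -/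
open Set

noncomputable section

/-- The value function of a binary ECU: the utility `u` is used when the probability of
disappointing prizes is at most `τ`, and `v` is used when it exceeds `τ`. -/
def binaryECUval (w b d τ : ℝ) (u v : ℝ → ℝ) (r : ℝ → ℝ) : ℝ :=
  if prob r (Icc w d) ≤ τ then ∑ᶠ x, r x * u x else ∑ᶠ x, r x * v x

/-- The betweenness axiom for a preference relation on simple lotteries. -/
def Betweenness (w b : ℝ) (R : (ℝ → ℝ) → (ℝ → ℝ) → Prop) : Prop :=
  ∀ p q, IsLottery w b p → IsLottery w b q →
    (StrictPref R p q → ∀ α ∈ Ioo (0:ℝ) 1, StrictPref R p (α • p + (1 - α) • q)) ∧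
    (Indiff R p q → ∀ α ∈ Icc (0:ℝ) 1, Indiff R p (α • p + (1 - α) • q))

/-- The function with values `a`, `c`, `e` at the prizes `0`, `1`, `3`, and `0` elsewhere. -/
def threePoint (a c e : ℝ) : ℝ → ℝ :=
  fun x => if x = 0 then a else if x = 1 then c else if x = 3 then e else 0

theorem support_threePoint_mul_subset (a c e : ℝ) (f : ℝ → ℝ) :
    Function.support (fun x => threePoint a c e x * f x) ⊆ (({0, 1, 3} : Finset ℝ) : Set ℝ) := by
  intro x hx
  by_contra h
  simp only [Finset.coe_insert, Finset.coe_singleton, mem_insert_iff, mem_singleton_iff,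
    not_or] at h
  exact hx (by simp [threePoint, h])

theorem finsum_threePoint_mul (a c e : ℝ) (f : ℝ → ℝ) :
    ∑ᶠ x, threePoint a c e x * f x = a * f 0 + c * f 1 + e * f 3 := by
  rw [finsum_eq_sum_of_support_subset _ (support_threePoint_mul_subset a c e f)]
  simp [threePoint, Finset.sum_insert, add_assoc]

theorem isLottery_threePoint {a c e : ℝ} (ha : 0 ≤ a) (hc : 0 ≤ c) (he : 0 ≤ e)
    (h : a + c + e = 1) : IsLottery 0 3 (threePoint a c e) := by
  refine ⟨?_, ?_, ?_, ?_⟩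
  · exact (Finset.finite_toSet {0, 1, 3}).subset
      (by simpa using support_threePoint_mul_subset a c e 1)
  · intro x
    unfold threePoint
    split_ifs <;> constructor <;> linarith
  · intro x hx
    have h0 : x ≠ 0 := by rintro rfl; exact hx (by norm_num)
    have h1 : x ≠ 1 := by rintro rfl; exact hx (by norm_num)
    have h3 : x ≠ 3 := by rintro rfl; exact hx (by norm_num)
    simp [threePoint, h0, h1, h3]
  · simpa [h] using finsum_threePoint_mul a c e 1

theorem prob_threePoint (a c e : ℝ) : prob (threePoint a c e) (Icc 0 1) = a + c := by
  have h := finsum_threePoint_mul a c e ((Icc (0 : ℝ) 1).indicator 1)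
  have h3 : (3 : ℝ) ∉ Icc (0 : ℝ) 1 := by norm_num
  rw [prob, finsum_mem_def]
  simpa [indicator_apply, h3] using h

theorem smul_threePoint_add (s t a c e a' c' e' : ℝ) :
    s • threePoint a c e + t • threePoint a' c' e' =
      threePoint (s * a + t * a') (s * c + t * c') (s * e + t * e') := by
  ext x
  simp only [threePoint, Pi.add_apply, Pi.smul_apply, smul_eq_mul]
  split_ifs <;> simp

theorem binaryECUval_threePoint (τ : ℝ) (u v : ℝ → ℝ) (a c e : ℝ) :
    binaryECUval 0 3 1 τ u v (threePoint a c e) =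
      if a + c ≤ τ then a * u 0 + c * u 1 + e * u 3 else a * v 0 + c * v 1 + e * v 3 := by
  simp only [binaryECUval, prob_threePoint, finsum_threePoint_mul]

/-- Betweenness fails for a relation represented by `V` as soon as some mixture of `p` and a
strictly worse `q` is strictly better than `p`. -/
theorem not_betweenness_of_mixture_lt {w b α : ℝ} {V : (ℝ → ℝ) → ℝ} {p q : ℝ → ℝ}
    (hp : IsLottery w b p) (hq : IsLottery w b q) (hα : α ∈ Ioo (0 : ℝ) 1) (hqp : V q < V p)
    (hmix : V p < V (α • p + (1 - α) • q)) : ¬ Betweenness w b (fun p' q' => V q' ≤ V p') :=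
  fun h => ((h p q hp hq).1 ⟨hqp.le, hqp.not_ge⟩ α hα).1.not_gt hmix

/-- There is a binary ECU (with strictly increasing `u`, `v` agreeing at the endpoints and
`v < u` in between) and lotteries `p, q` with `V(p) > V(q)` but
`V(0.6p + 0.4q) > V(p)`; in particular the represented preferences violate betweenness. -/
theorem stmt_18 : ∃ w b : ℝ, w < b ∧ ∃ d ∈ Icc w b, ∃ τ ∈ Ioo (0:ℝ) 1,
    ∃ u v : ℝ → ℝ, StrictMonoOn u (Icc w b) ∧ StrictMonoOn v (Icc w b) ∧
      u w = v w ∧ u b = v b ∧ (∀ x ∈ Ioo w b, v x < u x) ∧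
      ∃ p q : ℝ → ℝ, IsLottery w b p ∧ IsLottery w b q ∧
        binaryECUval w b d τ u v q < binaryECUval w b d τ u v p ∧
        binaryECUval w b d τ u v p <
          binaryECUval w b d τ u v ((0.6 : ℝ) • p + (0.4 : ℝ) • q) ∧
        ¬ Betweenness w b
          (fun p' q' => binaryECUval w b d τ u v q' ≤ binaryECUval w b d τ u v p') := by
  have hp : IsLottery 0 3 (threePoint 0 (9 / 10) (1 / 10)) := by
    apply isLottery_threePoint <;> norm_num
  have hq : IsLottery 0 3 (threePoint (17 / 20) 0 (3 / 20)) := by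
    apply isLottery_threePoint <;> norm_num
  have hqp : binaryECUval 0 3 1 (22 / 25) (fun x => x) (fun x => x ^ 2 / 3)
        (threePoint (17 / 20) 0 (3 / 20)) <
      binaryECUval 0 3 1 (22 / 25) (fun x => x) (fun x => x ^ 2 / 3)
        (threePoint 0 (9 / 10) (1 / 10)) := by
    simp only [binaryECUval_threePoint]
    norm_num
  have hmix : binaryECUval 0 3 1 (22 / 25) (fun x => x) (fun x => x ^ 2 / 3)
        (threePoint 0 (9 / 10) (1 / 10)) <
      binaryECUval 0 3 1 (22 / 25) (fun x => x) (fun x => x ^ 2 / 3)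
        ((0.6 : ℝ) • threePoint 0 (9 / 10) (1 / 10) +
          (0.4 : ℝ) • threePoint (17 / 20) 0 (3 / 20)) := by
    simp only [smul_threePoint_add, binaryECUval_threePoint]
    norm_num
  refine ⟨0, 3, by norm_num, 1, by norm_num, 22 / 25, by norm_num, fun x => x,
    fun x => x ^ 2 / 3, strictMono_id.strictMonoOn _, ?_, by norm_num, by norm_num, ?_,
    _, _, hp, hq, hqp, hmix, ?_⟩
  · intro x hx y _ hxy
    have := hx.1
    show x ^ 2 / 3 < y ^ 2 / 3
    gcongr
  · rintro x ⟨h0, h3⟩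
    show x ^ 2 / 3 < x
    nlinarith
  · refine not_betweenness_of_mixture_lt (α := 0.6) hp hq (by norm_num) hqp ?_
    rwa [show (1 - 0.6 : ℝ) = 0.4 by norm_num]
end
end
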